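/- Let L be a domain, let E be a quasisober topological space, and let ν be an L-valued maxitive measure on the Borel σ-algebra ℬ of E. The following are equivalent: (1) ν is regular; (2) ν has a usc cardinal density; (3) ν is outer-continuous and completely maxitive; (4) ν is weakly outer-continuous and weakly inner-continuous. -/

import Mathlib

open Set

universe u v

section OrderDefs
variable {L : Type u} [PartialOrder L]

/-- A filtered (nonempty, downward directed) subset of a poset. -/
def DirFiltered (F : Set L) : Prop :=
  F.Nonempty ∧ ∀ r ∈ F, ∀ s ∈ F, ∃ t ∈ F, t ≤ r ∧ t ≤ s

/-- A filter of a poset: a filtered upper set. -/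
def OrdFilter (F : Set L) : Prop :=
  DirFiltered F ∧ ∀ r ∈ F, ∀ s : L, r ≤ s → s ∈ F

/-- Every filter has an infimum. -/
def FilteredComplete (L : Type u) [PartialOrder L] : Prop :=
  ∀ F : Set L, OrdFilter F → ∃ i : L, IsGLB F i

/-- `s` is way-above `r`: for every filter `F` with an infimum below `r`, `s ∈ F`. -/
def WayAbove (s r : L) : Prop :=
  ∀ F : Set L, OrdFilter F → ∀ i : L, IsGLB F i → i ≤ r → s ∈ F

/-- The poset is continuous: for every `r`, the set of elements way-above `r`
is a filter whose infimum is `r`. -/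
def ContinuousPoset (L : Type u) [PartialOrder L] : Prop :=
  ∀ r : L, OrdFilter {s : L | WayAbove s r} ∧ IsGLB {s : L | WayAbove s r} r

/-- Conditional completeness: every nonempty set bounded above has a supremum. -/
def CondComplete (L : Type u) [PartialOrder L] : Prop :=
  ∀ S : Set L, S.Nonempty → BddAbove S → ∃ m : L, IsLUB S m

end OrderDefs

/-- A domain: a filtered-complete continuous poset with a least element. -/
def DomainPoset (L : Type u) [PartialOrder L] [OrderBot L] : Prop :=
  FilteredComplete L ∧ ContinuousPoset L

section TopDefs
variable {E : Type v} [TopologicalSpace E]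

/-- The saturation of a set: intersection of all open sets containing it. -/
def satur (A : Set E) : Set E := ⋂₀ {G : Set E | IsOpen G ∧ A ⊆ G}

/-- A set is saturated if it is an intersection of open sets. -/
def IsSatur (A : Set E) : Prop :=
  ∃ 𝒢 : Set (Set E), (∀ G ∈ 𝒢, IsOpen G) ∧ A = ⋂₀ 𝒢

/-- The collection 𝒬 of compact saturated subsets. -/
def CompactSat (E : Type v) [TopologicalSpace E] : Set (Set E) :=
  {A : Set E | IsCompact A ∧ IsSatur A}

/-- The Borel σ-algebra generated by open sets and compact saturated sets. -/
def BorelM (E : Type v) [TopologicalSpace E] : MeasurableSpace E :=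
  MeasurableSpace.generateFrom ({A : Set E | IsOpen A} ∪ CompactSat E)

/-- Borel subsets for the σ-algebra generated by opens and compact saturated sets. -/
def IsBorelSet (B : Set E) : Prop := @MeasurableSet E (BorelM E) B

/-- The collection 𝒦 of compact Borel subsets. -/
def CompactBorel (E : Type v) [TopologicalSpace E] : Set (Set E) :=
  {A : Set E | IsBorelSet A ∧ IsCompact A}

/-- `[x]` : the compact Borel set `↑{x} ∩ closure {x}`. -/
def ptClass (x : E) : Set E := satur {x} ∩ closure {x}

end TopDefs

section MeasDefs
variable {L : Type u} {E : Type v} [PartialOrder L] [OrderBot L] [TopologicalSpace E]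

/-- An L-valued maxitive measure on the Borel σ-algebra. -/
def Maxitive (ν : Set E → L) : Prop :=
  ν ∅ = ⊥ ∧ ∀ 𝒞 : Set (Set E), 𝒞.Finite → (∀ B ∈ 𝒞, IsBorelSet B) →
    IsLUB (ν '' 𝒞) (ν (⋃₀ 𝒞))

/-- σ-maxitivity. -/
def SigmaMaxitive (ν : Set E → L) : Prop :=
  Maxitive ν ∧ ∀ 𝒞 : Set (Set E), 𝒞.Countable → (∀ B ∈ 𝒞, IsBorelSet B) →
    IsLUB (ν '' 𝒞) (ν (⋃₀ 𝒞))

/-- Complete maxitivity. -/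
def CompletelyMaxitive (ν : Set E → L) : Prop :=
  Maxitive ν ∧ ∀ 𝒞 : Set (Set E), (∀ B ∈ 𝒞, IsBorelSet B) → IsBorelSet (⋃₀ 𝒞) →
    IsLUB (ν '' 𝒞) (ν (⋃₀ 𝒞))

/-- The set `{ν G : G open, G ⊇ B}`. -/
def outerVals (ν : Set E → L) (B : Set E) : Set L :=
  {l : L | ∃ G : Set E, IsOpen G ∧ B ⊆ G ∧ ν G = l}

/-- `νp` is the map `ν⁺ : B ↦ inf {ν G : G open, G ⊇ B}` on Borel sets. -/
def IsNuPlus (ν νp : Set E → L) : Prop :=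
  ∀ B : Set E, IsBorelSet B → IsGLB (outerVals ν B) (νp B)

/-- Outer-continuity. -/
def OuterContinuous (ν : Set E → L) : Prop :=
  ∀ B : Set E, IsBorelSet B → IsGLB (outerVals ν B) (ν B)

/-- Inner-continuity. -/
def InnerContinuous (ν : Set E → L) : Prop :=
  ∀ B : Set E, IsBorelSet B →
    IsLUB {l : L | ∃ K : Set E, IsBorelSet K ∧ IsCompact K ∧ K ⊆ B ∧ ν (satur K) = l} (ν B)

/-- Regularity: inner- and outer-continuity. -/
def RegularMeasure (ν : Set E → L) : Prop :=
  InnerContinuous ν ∧ OuterContinuous ν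

/-- Weak outer-continuity: `ν K = ν⁺ K` for every compact Borel `K`. -/
def WeaklyOuterContinuous (ν : Set E → L) : Prop :=
  ∀ K : Set E, IsBorelSet K → IsCompact K → IsGLB (outerVals ν K) (ν K)

/-- Weak inner-continuity (relative to a given `ν⁺ = νp`). -/
def WeaklyInnerContinuous (ν νp : Set E → L) : Prop :=
  ∀ G : Set E, IsOpen G →
    IsLUB {l : L | ∃ K : Set E, IsBorelSet K ∧ IsCompact K ∧ K ⊆ G ∧ νp K = l} (ν G)

/-- 𝒜-smoothness. -/
def SmoothWrt (ν : Set E → L) (𝒜 : Set (Set E)) : Prop :=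
  ∀ 𝒟 : Set (Set E), 𝒟.Nonempty → 𝒟 ⊆ 𝒜 → DirectedOn (· ⊇ ·) 𝒟 →
    IsGLB (ν '' 𝒟) (ν (⋂₀ 𝒟))

/-- Saturation of a maxitive measure: `ν K = ν (↑K)` for compact Borel `K`. -/
def SaturatedMeasure (ν : Set E → L) : Prop :=
  ∀ K : Set E, IsBorelSet K → IsCompact K → ν K = ν (satur K)

/-- Tightness: `inf {ν (E ∖ K) : K compact Borel} = 0`. -/
def TightMeasure (ν : Set E → L) : Prop :=
  IsGLB {l : L | ∃ K : Set E, IsBorelSet K ∧ IsCompact K ∧ ν Kᶜ = l} (⊥ : L)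

/-- `c` is a cardinal density of `ν`. -/
def IsCardinalDensity (ν : Set E → L) (c : E → L) : Prop :=
  ∀ B : Set E, IsBorelSet B → IsLUB (c '' B) (ν B)

/-- Upper semicontinuity of a map into the poset. -/
def UscMap (c : E → L) : Prop := ∀ t : L, IsOpen {x : E | WayAbove t (c x)}

/-- Upper compactness of a map into the poset. -/
def UpperCompactMap (c : E → L) : Prop :=
  ∀ t : L, WayAbove t (⊥ : L) → IsCompact {x : E | ¬ WayAbove t (c x)}

/-- Continuity from above along decreasing sequences of Borel sets. -/
def ContinuousFromAbove (ν : Set E → L) : Prop :=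
  ∀ B : ℕ → Set E, (∀ n, IsBorelSet (B n)) → (∀ n, B (n + 1) ⊆ B n) →
    IsGLB (Set.range fun n => ν (B n)) (ν (⋂ n, B n))

/-- An optimal measure: a σ-maxitive measure continuous from above. -/
def OptimalMeasure (ν : Set E → L) : Prop :=
  SigmaMaxitive ν ∧ ContinuousFromAbove ν

/-- `flo` is the regular part `⌊ν⌋` (relative to `νp = ν⁺`):
`⌊ν⌋(B) = sup {ν⁺(K) : K compact Borel, K ⊆ B}`. -/
def RegPartRel (νp flo : Set E → L) : Prop :=
  ∀ B : Set E, IsBorelSet B →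
    IsLUB {l : L | ∃ K : Set E, IsBorelSet K ∧ IsCompact K ∧ K ⊆ B ∧ νp K = l} (flo B)

end MeasDefs

section Order
variable {L : Type u} [PartialOrder L]

lemma WayAbove.le {s r : L} (h : WayAbove s r) : r ≤ s :=
  h (Ici r) ⟨⟨⟨r, le_rfl⟩, fun _ ha _ hb => ⟨r, le_rfl, ha, hb⟩⟩,
    fun _ ha _ hb => le_trans ha hb⟩ r isGLB_Ici le_rfl

lemma WayAbove.mono {s r q : L} (h : WayAbove s r) (hq : q ≤ r) : WayAbove s q :=
  fun F hF i hi hir => h F hF i hi (hir.trans hq)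

lemma ContinuousPoset.le_of_forall_wayAbove (hC : ContinuousPoset L) {a r : L}
    (h : ∀ t, WayAbove t r → a ≤ t) : a ≤ r :=
  (hC r).2.2 fun t ht => h t ht

/-- The interpolation property of the way-above relation. -/
lemma ContinuousPoset.exists_between (hC : ContinuousPoset L) {t r : L} (h : WayAbove t r) :
    ∃ s, WayAbove t s ∧ WayAbove s r := by
  refine h {u | ∃ s, WayAbove u s ∧ WayAbove s r} ⟨⟨?_, ?_⟩, ?_⟩ r ⟨?_, ?_⟩ le_rfl
  · obtain ⟨s, hs⟩ := (hC r).1.1.1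
    obtain ⟨u, hu⟩ := (hC s).1.1.1
    exact ⟨u, s, hu, hs⟩
  · rintro u₁ ⟨s₁, hu₁, hs₁⟩ u₂ ⟨s₂, hu₂, hs₂⟩
    obtain ⟨s, hs, h₁, h₂⟩ := (hC r).1.1.2 s₁ hs₁ s₂ hs₂
    obtain ⟨u, hu, h₃, h₄⟩ := (hC s).1.1.2 u₁ (hu₁.mono h₁) u₂ (hu₂.mono h₂)
    exact ⟨u, ⟨s, hu, hs⟩, h₃, h₄⟩
  · rintro u ⟨s, hu, hs⟩ v huv
    exact ⟨s, (hC s).1.2 u hu v huv, hs⟩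
  · rintro u ⟨s, hu, hs⟩
    exact hs.le.trans hu.le
  · exact fun i hi => hC.le_of_forall_wayAbove fun s hs =>
      hC.le_of_forall_wayAbove fun u hu => hi ⟨s, hu, hs⟩

end Order

section Saturation
variable {E : Type v} [TopologicalSpace E]

lemma subset_satur (A : Set E) : A ⊆ satur A :=
  subset_sInter fun _ hG => hG.2

lemma IsOpen.satur_subset_iff {A G : Set E} (hG : IsOpen G) : satur A ⊆ G ↔ A ⊆ G :=
  ⟨(subset_satur A).trans, fun h => sInter_subset_of_mem ⟨hG, h⟩⟩

lemma IsCompact.satur {K : Set E} (hK : IsCompact K) : IsCompact (satur K) := by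
  refine isCompact_of_finite_subcover fun U hU hKU => ?_
  obtain ⟨t, ht⟩ := hK.elim_finite_subcover U hU ((subset_satur K).trans hKU)
  exact ⟨t, (isOpen_biUnion fun i _ => hU i).satur_subset_iff.2 ht⟩

lemma IsOpen.isBorelSet {G : Set E} (hG : IsOpen G) : IsBorelSet G :=
  MeasurableSpace.measurableSet_generateFrom (Or.inl hG)

lemma IsCompact.isBorelSet_satur {K : Set E} (hK : IsCompact K) : IsBorelSet (_root_.satur K) :=
  MeasurableSpace.measurableSet_generateFrom (Or.inr ⟨hK.satur, _, fun _ hG => hG.1, rfl⟩)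

lemma mem_satur_singleton {x y : E} : y ∈ satur {x} ↔ y ⤳ x := by
  simp [satur, specializes_iff_forall_open]

lemma mem_ptClass {x y : E} : y ∈ ptClass x ↔ Inseparable x y := by
  rw [ptClass, mem_inter_iff, mem_satur_singleton, ← specializes_iff_mem_closure,
    inseparable_iff_specializes_and, and_comm]

lemma self_mem_ptClass (x : E) : x ∈ ptClass x :=
  mem_ptClass.2 .rfl

lemma IsOpen.ptClass_subset_iff {G : Set E} (hG : IsOpen G) {x : E} :
    ptClass x ⊆ G ↔ x ∈ G :=
  ⟨fun h => h (self_mem_ptClass x),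
    fun h _ hy => ((mem_ptClass.1 hy).mem_open_iff hG).1 h⟩

lemma isCompact_ptClass (x : E) : IsCompact (ptClass x) := by
  refine isCompact_of_finite_subcover fun U hU hKU => ?_
  obtain ⟨i, hi⟩ := mem_iUnion.1 (hKU (self_mem_ptClass x))
  exact ⟨{i}, by simpa using (hU i).ptClass_subset_iff.2 hi⟩

lemma isBorelSet_ptClass (x : E) : IsBorelSet (ptClass x) :=
  @MeasurableSet.inter E (BorelM E) _ _ isCompact_singleton.isBorelSet_satur <| by
    simpa using @MeasurableSet.compl E _ (BorelM E)
      (isClosed_closure (s := {x})).isOpen_compl.isBorelSet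

lemma IsBorelSet.mem_iff_of_inseparable {B : Set E} (hB : IsBorelSet B) {x y : E}
    (h : Inseparable x y) : x ∈ B ↔ y ∈ B := by
  refine MeasurableSpace.generateFrom_induction _ (fun B _ => (x ∈ B ↔ y ∈ B))
    ?_ Iff.rfl (fun _ _ ih => not_congr ih) ?_ B hB
  · rintro B (hB | ⟨-, 𝒢, h𝒢, rfl⟩) -
    · exact h.mem_open_iff hB
    · exact forall₂_congr fun G hG => h.mem_open_iff (h𝒢 G hG)
  · intro f _ ih
    simp only [mem_iUnion, ih]

lemma IsBorelSet.ptClass_subset {B : Set E} (hB : IsBorelSet B) {x : E} (hx : x ∈ B) :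
    ptClass x ⊆ B :=
  fun _ hy => (hB.mem_iff_of_inseparable (mem_ptClass.1 hy)).1 hx

end Saturation

section Measures
variable {L : Type u} {E : Type v} [PartialOrder L] [OrderBot L] [TopologicalSpace E]
  {ν νp : Set E → L} {c : E → L}

lemma Maxitive.mono (hν : Maxitive ν) {A B : Set E} (hA : IsBorelSet A) (hB : IsBorelSet B)
    (hAB : A ⊆ B) : ν A ≤ ν B := by
  have h := (hν.2 {A, B} (by simp) (by simp [hA, hB])).1 (mem_image_of_mem ν (mem_insert A {B}))
  rwa [sUnion_pair, union_eq_self_of_subset_left hAB] at h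

lemma outerVals_satur (ν : Set E → L) (K : Set E) : outerVals ν (satur K) = outerVals ν K := by
  ext l
  exact exists_congr fun G => and_congr_right fun hG => by rw [hG.satur_subset_iff]

lemma OuterContinuous.map_satur (h : OuterContinuous ν) {K : Set E} (hK : IsBorelSet K)
    (hKc : IsCompact K) : ν (satur K) = ν K :=
  (outerVals_satur ν K ▸ h _ hKc.isBorelSet_satur).unique (h K hK)

lemma Maxitive.exists_isOpen_le (hν : Maxitive ν) {B : Set E} {r t : L}
    (hr : IsGLB (outerVals ν B) r) (ht : WayAbove t r) :
    ∃ G, IsOpen G ∧ B ⊆ G ∧ ν G ≤ t := by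
  refine ht {s | ∃ G, IsOpen G ∧ B ⊆ G ∧ ν G ≤ s} ⟨⟨?_, ?_⟩, ?_⟩ r ⟨?_, ?_⟩ le_rfl
  · exact ⟨_, univ, isOpen_univ, subset_univ B, le_rfl⟩
  · rintro s₁ ⟨G₁, hG₁, hB₁, h₁⟩ s₂ ⟨G₂, hG₂, hB₂, h₂⟩
    have hG := hG₁.inter hG₂
    exact ⟨_, ⟨G₁ ∩ G₂, hG, subset_inter hB₁ hB₂, le_rfl⟩,
      (hν.mono hG.isBorelSet hG₁.isBorelSet inter_subset_left).trans h₁,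
      (hν.mono hG.isBorelSet hG₂.isBorelSet inter_subset_right).trans h₂⟩
  · rintro s ⟨G, hG, hB, h⟩ u hu
    exact ⟨G, hG, hB, h.trans hu⟩
  · rintro s ⟨G, hG, hB, h⟩
    exact (hr.1 ⟨G, hG, hB, rfl⟩).trans h
  · rintro i hi
    refine hr.2 ?_
    rintro _ ⟨G, hG, hB, rfl⟩
    exact hi ⟨G, hG, hB, le_rfl⟩

lemma IsCardinalDensity.completelyMaxitive (hν : Maxitive ν) (h : IsCardinalDensity ν c) :
    CompletelyMaxitive ν := by
  refine ⟨hν, fun 𝒞 h𝒞 hU => ⟨?_, fun u hu => (h _ hU).2 ?_⟩⟩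
  · rintro _ ⟨B, hB, rfl⟩
    exact hν.mono (h𝒞 B hB) hU (subset_sUnion_of_mem hB)
  · rintro _ ⟨x, ⟨B, hB, hx⟩, rfl⟩
    exact ((h B (h𝒞 B hB)).1 ⟨x, hx, rfl⟩).trans (hu ⟨B, hB, rfl⟩)

lemma IsCardinalDensity.outerContinuous (hC : ContinuousPoset L) (hν : Maxitive ν)
    (hc : UscMap c) (h : IsCardinalDensity ν c) : OuterContinuous ν := by
  refine fun B hB => ⟨?_, fun i hi => hC.le_of_forall_wayAbove fun t ht => ?_⟩
  · rintro _ ⟨G, hG, hBG, rfl⟩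
    exact hν.mono hB hG.isBorelSet hBG
  · refine (hi ⟨{x | WayAbove t (c x)}, hc t, fun x hx => ht.mono ((h B hB).1 ⟨x, hx, rfl⟩),
      rfl⟩).trans ((h _ (hc t).isBorelSet).2 ?_)
    rintro _ ⟨x, hx, rfl⟩
    exact WayAbove.le hx

lemma IsCardinalDensity.regularMeasure (hC : ContinuousPoset L) (hν : Maxitive ν)
    (hc : UscMap c) (h : IsCardinalDensity ν c) : RegularMeasure ν := by
  have ho := h.outerContinuous hC hν hc
  refine ⟨fun B hB => ⟨?_, fun u hu => (h B hB).2 ?_⟩, ho⟩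
  · rintro _ ⟨K, hK, hKc, hKB, rfl⟩
    exact (ho.map_satur hK hKc).trans_le (hν.mono hK hB hKB)
  · rintro _ ⟨x, hx, rfl⟩
    refine ((h _ isCompact_singleton.isBorelSet_satur).1 ⟨x, subset_satur _ rfl, rfl⟩).trans ?_
    refine le_of_eq_of_le ?_ (hu ⟨ptClass x, isBorelSet_ptClass x, isCompact_ptClass x,
      hB.ptClass_subset hx, rfl⟩)
    congr 1
    exact Subset.antisymm
      (subset_sInter fun G hG => hG.1.satur_subset_iff.2 (by
        simpa using hG.1.ptClass_subset_iff.1 hG.2))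
      (subset_sInter fun G hG => hG.1.satur_subset_iff.2
        (hG.1.ptClass_subset_iff.2 (by simpa using hG.2)))

lemma WeaklyOuterContinuous.uscMap_ptClass (hC : ContinuousPoset L) (hν : Maxitive ν)
    (h : WeaklyOuterContinuous ν) : UscMap fun x => ν (ptClass x) := by
  refine fun t => isOpen_iff_forall_mem_open.2 fun x hx => ?_
  obtain ⟨s, hts, hsx⟩ := hC.exists_between hx
  obtain ⟨G, hG, hxG, hGs⟩ :=
    hν.exists_isOpen_le (h _ (isBorelSet_ptClass x) (isCompact_ptClass x)) hsx
  exact ⟨G, fun y hy => hts.mono ((hν.mono (isBorelSet_ptClass y) hG.isBorelSet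
    (hG.ptClass_subset_iff.2 hy)).trans hGs), hG, hG.ptClass_subset_iff.1 hxG⟩

lemma OuterContinuous.weaklyOuterContinuous (h : OuterContinuous ν) : WeaklyOuterContinuous ν :=
  fun K hK _ => h K hK

lemma CompletelyMaxitive.isCardinalDensity_ptClass (h : CompletelyMaxitive ν) :
    IsCardinalDensity ν fun x => ν (ptClass x) := by
  intro B hB
  have hU : ⋃₀ (ptClass '' B) = B := by
    refine Subset.antisymm (sUnion_subset ?_) fun x hx => ⟨_, ⟨x, hx, rfl⟩, self_mem_ptClass x⟩
    rintro _ ⟨x, hx, rfl⟩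
    exact hB.ptClass_subset hx
  have := h.2 (ptClass '' B) (by rintro _ ⟨x, -, rfl⟩; exact isBorelSet_ptClass x) (hU.symm ▸ hB)
  rwa [hU, image_image] at this

lemma WeaklyOuterContinuous.le_of_forall_ptClass_le (hC : ContinuousPoset L) (hν : Maxitive ν)
    (h : WeaklyOuterContinuous ν) {K : Set E} (hK : IsBorelSet K) (hKc : IsCompact K) {u : L}
    (hu : ∀ x ∈ K, ν (ptClass x) ≤ u) : ν K ≤ u := by
  refine hC.le_of_forall_wayAbove fun t ht => ?_
  have hx : ∀ x : K, ∃ G, IsOpen G ∧ ptClass x.1 ⊆ G ∧ ν G ≤ t := fun x =>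
    hν.exists_isOpen_le (h _ (isBorelSet_ptClass x.1) (isCompact_ptClass x.1))
      (ht.mono (hu x x.2))
  choose G hG hxG hGt using hx
  obtain ⟨s, hs⟩ := hKc.elim_finite_subcover G hG fun x hx =>
    mem_iUnion.2 ⟨⟨x, hx⟩, hxG ⟨x, hx⟩ (self_mem_ptClass x)⟩
  have hLUB := hν.2 (G '' s) (s.finite_toSet.image G) (by
    rintro _ ⟨x, -, rfl⟩
    exact (hG x).isBorelSet)
  have hO : IsOpen (⋃₀ (G '' s)) := isOpen_sUnion (by rintro _ ⟨x, -, rfl⟩; exact hG x)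
  refine (hν.mono hK hO.isBorelSet (by simpa [sUnion_image] using hs)).trans (hLUB.2 ?_)
  rintro _ ⟨_, ⟨x, -, rfl⟩, rfl⟩
  exact hGt x

lemma WeaklyInnerContinuous.isCardinalDensity_ptClass (hC : ContinuousPoset L)
    (hν : Maxitive ν) (hνp : IsNuPlus ν νp) (ho : WeaklyOuterContinuous ν)
    (hi : WeaklyInnerContinuous ν νp) : IsCardinalDensity ν fun x => ν (ptClass x) := by
  refine fun B hB => ⟨?_, fun u hu => hC.le_of_forall_wayAbove fun t ht => ?_⟩
  · rintro _ ⟨x, hx, rfl⟩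
    exact hν.mono (isBorelSet_ptClass x) hB (hB.ptClass_subset hx)
  · have hG := ho.uscMap_ptClass hC hν t
    refine (hν.mono hB hG.isBorelSet fun x hx => ht.mono (hu ⟨x, hx, rfl⟩)).trans ((hi _ hG).2 ?_)
    rintro _ ⟨K, hK, hKc, hKG, rfl⟩
    rw [(hνp K hK).unique (ho K hK hKc)]
    exact ho.le_of_forall_ptClass_le hC hν hK hKc fun x hx => WayAbove.le (hKG hx)

lemma RegularMeasure.weaklyInnerContinuous (hνp : IsNuPlus ν νp) (h : RegularMeasure ν) :
    WeaklyInnerContinuous ν νp := by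
  intro G hG
  convert h.1 G hG.isBorelSet using 1
  ext l
  refine exists_congr fun K => and_congr_right fun hK => and_congr_right fun hKc => ?_
  rw [h.2.map_satur hK hKc, (hνp K hK).unique (h.2 K hK)]

end Measures

/-- equivalence of regularity, usc cardinal density,
outer-continuity + complete maxitivity, and weak outer- + weak inner-continuity. -/
theorem stmt1 {L : Type u} {E : Type v} [PartialOrder L] [OrderBot L]
    [TopologicalSpace E] [QuasiSober E] (hL : DomainPoset L)
    (ν νp : Set E → L) (hν : Maxitive ν) (hνp : IsNuPlus ν νp) :
    (RegularMeasure ν ↔ ∃ c : E → L, UscMap c ∧ IsCardinalDensity ν c) ∧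
    (RegularMeasure ν ↔ OuterContinuous ν ∧ CompletelyMaxitive ν) ∧
    (RegularMeasure ν ↔ WeaklyOuterContinuous ν ∧ WeaklyInnerContinuous ν νp) := by
  have hC := hL.2
  have h₁₄ : RegularMeasure ν → WeaklyOuterContinuous ν ∧ WeaklyInnerContinuous ν νp :=
    fun h => ⟨h.2.weaklyOuterContinuous, h.weaklyInnerContinuous hνp⟩
  have h₄₂ : WeaklyOuterContinuous ν ∧ WeaklyInnerContinuous ν νp →
      ∃ c : E → L, UscMap c ∧ IsCardinalDensity ν c :=
    fun h => ⟨_, h.1.uscMap_ptClass hC hν, h.2.isCardinalDensity_ptClass hC hν hνp h.1⟩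
  have h₂₁ : (∃ c : E → L, UscMap c ∧ IsCardinalDensity ν c) → RegularMeasure ν :=
    fun ⟨_, hc, h⟩ => h.regularMeasure hC hν hc
  refine ⟨⟨h₄₂ ∘ h₁₄, h₂₁⟩, ⟨fun h => ?_, fun h => ?_⟩, ⟨h₁₄, h₂₁ ∘ h₄₂⟩⟩
  · obtain ⟨c, -, hc⟩ := h₄₂ (h₁₄ h)
    exact ⟨h.2, hc.completelyMaxitive hν⟩
  · exact h₂₁ ⟨_, h.1.weaklyOuterContinuous.uscMap_ptClass hC hν,
      h.2.isCardinalDensity_ptClass⟩
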